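/- For a finite multigraph Γ, b₁(Γ) belongs to the set of cyclic Betti numbers B_Γ if and only if the subgraph obtained by deleting all separating edges of Γ is a cyclic subgraph. -/

import Mathlib

/-!
A finite multigraph on vertex type `V` with edge type `E`: each edge has a
(possibly diagonal, i.e. loop) unordered pair of endpoints in `Sym2 V`.
-/
structure Multigraph (V E : Type) where
  ends : E → Sym2 V

namespace Multigraph

variable {V E : Type} [Fintype V] [Fintype E] [DecidableEq V] [DecidableEq E]
variable (G : Multigraph V E)

/-- Valency of the vertex `v` in the subgraph with edge set `Δ`; a loop counts twice. -/
def deg (Δ : Finset E) (v : V) : ℕ :=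
  ∑ e ∈ Δ, (if G.ends e = Sym2.diag v then 2 else if v ∈ G.ends e then 1 else 0)

/-- `Δ` is a cyclic subgraph (even subset of edges): all valencies are even. -/
def IsCyclic (Δ : Finset E) : Prop := ∀ v, Even (G.deg Δ v)

instance (Δ : Finset E) : Decidable (G.IsCyclic Δ) :=
  decidable_of_iff (∀ v, Even (G.deg Δ v)) Iff.rfl

/-- Vertices of the subgraph generated by the edge set `Δ`. -/
def verts (Δ : Finset E) : Finset V :=
  Finset.univ.filter (fun v => ∃ e ∈ Δ, v ∈ G.ends e)

/-- Adjacency through an edge of `Δ`. -/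
def Adj (Δ : Finset E) (v w : V) : Prop := ∃ e ∈ Δ, G.ends e = s(v, w)

/-- Connectedness relation of the subgraph with edge set `Δ`. -/
def Reach (Δ : Finset E) : V → V → Prop := Relation.ReflTransGen (G.Adj Δ)

/-- Number of connected components of the subgraph generated by `Δ`
(only vertices incident to an edge of `Δ` are taken into account). -/
noncomputable def ncomp (Δ : Finset E) : ℕ :=
  Set.ncard { S : Set V | ∃ v ∈ G.verts Δ, S = {w | G.Reach Δ v w} }

/-- Number of connected components of the spanning subgraph `(V, Δ)`. -/
noncomputable def ncompSpanning (Δ : Finset E) : ℕ :=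
  Set.ncard { S : Set V | ∃ v : V, S = {w | G.Reach Δ v w} }

/-- First Betti number `|E(Δ)| - |V(Δ)| + c(Δ)` of the subgraph generated by `Δ`. -/
noncomputable def b1 (Δ : Finset E) : ℤ :=
  (Δ.card : ℤ) - (G.verts Δ).card + G.ncomp Δ

/-- The set of cyclic Betti numbers `B_Γ = {b₁(Δ) | Δ cyclic}`. -/
noncomputable def B : Set ℤ := { n | ∃ Δ : Finset E, G.IsCyclic Δ ∧ G.b1 Δ = n }

/-- The boundary of an `𝔽₂` 1-chain: an edge is sent to the sum of its endpoints
(so a loop is sent to `0`). -/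
def bndFun (x : E → ZMod 2) (v : V) : ZMod 2 :=
  ∑ e : E, x e * (if (G.ends e).IsDiag then 0 else if v ∈ G.ends e then 1 else 0)

/-- The boundary operator as an `𝔽₂`-linear map. -/
def bnd : (E → ZMod 2) →ₗ[ZMod 2] (V → ZMod 2) where
  toFun := G.bndFun
  map_add' x y := by
    funext v
    simp only [bndFun, Pi.add_apply, ← Finset.sum_add_distrib]
    exact Finset.sum_congr rfl fun e _ => by ring
  map_smul' c x := by
    funext v
    simp only [bndFun, Pi.smul_apply, smul_eq_mul, Finset.mul_sum, RingHom.id_apply]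
    exact Finset.sum_congr rfl fun e _ => by ring

/-- The cycle space `𝒞_Γ = ker ∂`. -/
def cycleSpace : Submodule (ZMod 2) (E → ZMod 2) := LinearMap.ker G.bnd

/-- The `𝔽₂` 1-chain associated to a set of edges. -/
def chainOf (Δ : Finset E) : E → ZMod 2 := fun e => if e ∈ Δ then 1 else 0

/-- Chains supported on a subset `E'` of the edges. -/
def supportedOn (E' : Finset E) : Submodule (ZMod 2) (E → ZMod 2) where
  carrier := {x | ∀ e, e ∉ E' → x e = 0}
  add_mem' := by intro x y hx hy e he; simp [hx e he, hy e he]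
  zero_mem' := by intro e he; rfl
  smul_mem' := by intro c x hx e he; simp [hx e he]

/-- The cycle space of the subgraph of `G` with edge set `E'`. -/
def cycleSpaceOn (E' : Finset E) : Submodule (ZMod 2) (E → ZMod 2) :=
  G.cycleSpace ⊓ supportedOn E'

/-- The set of cyclic Betti numbers of the subgraph with edge set `E'`. -/
noncomputable def BOn (E' : Finset E) : Set ℤ :=
  { n | ∃ Δ ⊆ E', G.IsCyclic Δ ∧ G.b1 Δ = n }

/-- `N` is a separating edge: deleting it increases the number of connected components. -/
def Separating (N : E) : Prop :=
  G.ncompSpanning Finset.univ < G.ncompSpanning (Finset.univ \ {N})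

/-- `G` is eulerian: every valency is even. -/
def Eulerian : Prop := ∀ v, Even (G.deg Finset.univ v)

/-- `G` is superstable: every vertex has valency at least `3`, except possibly
a vertex carrying a loop. -/
def Superstable : Prop :=
  ∀ v ∈ G.verts Finset.univ, 3 ≤ G.deg Finset.univ v ∨ ∃ e : E, G.ends e = Sym2.diag v

/-- A circuit: a nonempty connected subgraph all of whose valencies equal `2`. -/
def IsCircuit (Δ : Finset E) : Prop :=
  Δ.Nonempty ∧ (∀ v ∈ G.verts Δ, G.deg Δ v = 2) ∧
    ∀ v ∈ G.verts Δ, ∀ w ∈ G.verts Δ, G.Reach Δ v w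

/-- `G` is connected. -/
def Conn : Prop :=
  ∀ v ∈ G.verts Finset.univ, ∀ w ∈ G.verts Finset.univ, G.Reach Finset.univ v w

/-- The edges of `G` that are not separating. -/
noncomputable def nonSepEdges : Finset E :=
  @Finset.filter _ (fun N => ¬ G.Separating N) (Classical.decPred _) Finset.univ

end Multigraph

namespace Multigraph

variable {V E : Type} (G : Multigraph V E)

theorem Reach.symm {Δ : Finset E} {x y : V} (h : G.Reach Δ x y) : G.Reach Δ y x := by
  have hs : Std.Symm (G.Adj Δ) :=
    ⟨fun a b ⟨e, he, hab⟩ => ⟨e, he, hab.trans Sym2.eq_swap⟩⟩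
  exact Relation.ReflTransGen.stdSymm.symm _ _ h

theorem Reach.mono {Δ Δ' : Finset E} (h : Δ ⊆ Δ') {x y : V} (hxy : G.Reach Δ x y) :
    G.Reach Δ' x y :=
  Relation.ReflTransGen.mono
    (show G.Adj Δ ≤ G.Adj Δ' from fun _ _ ⟨e, he, hab⟩ => ⟨e, h he, hab⟩) _ _ hxy

theorem reach_of_mem {Δ : Finset E} {e : E} (he : e ∈ Δ) {u v : V} (huv : G.ends e = s(u, v)) :
    G.Reach Δ u v :=
  Relation.ReflTransGen.single ⟨e, he, huv⟩

/-- The vertex set of the connected component of `v` in the spanning subgraph `(V, Δ)`. -/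
def component (Δ : Finset E) (v : V) : Set V := {w | G.Reach Δ v w}

theorem component_eq_iff {Δ : Finset E} {x y : V} :
    G.component Δ x = G.component Δ y ↔ G.Reach Δ x y := by
  constructor
  · intro h
    have : y ∈ G.component Δ y := Relation.ReflTransGen.refl
    rw [← h] at this
    exact this
  · intro h
    ext w
    exact ⟨fun hw => (Reach.symm G h).trans hw, fun hw => h.trans hw⟩

theorem ncompSpanning_eq (Δ : Finset E) :
    G.ncompSpanning Δ = (Set.range (G.component Δ)).ncard := by
  unfold ncompSpanning
  congr 1
  ext S
  simp only [Set.mem_range, Set.mem_ofPred_eq, component, eq_comm]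

theorem reach_insert [DecidableEq E] {Δ : Finset E} {e : E} {u v : V}
    (huv : G.ends e = s(u, v)) {x y : V} :
    G.Reach (insert e Δ) x y ↔ G.Reach Δ x y ∨ (G.Reach Δ x u ∧ G.Reach Δ v y) ∨
      (G.Reach Δ x v ∧ G.Reach Δ u y) := by
  constructor
  · intro h
    induction h with
    | refl => exact Or.inl Relation.ReflTransGen.refl
    | @tail b c _ hbc ih =>
      obtain ⟨f, hf, hfe⟩ := hbc
      rcases Finset.mem_insert.1 hf with rfl | hf
      · rw [huv, Sym2.eq_iff] at hfe
        rcases hfe with ⟨rfl, rfl⟩ | ⟨rfl, rfl⟩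
        · rcases ih with h | ⟨h, -⟩ | ⟨h, -⟩
          · exact Or.inr (Or.inl ⟨h, Relation.ReflTransGen.refl⟩)
          · exact Or.inr (Or.inl ⟨h, Relation.ReflTransGen.refl⟩)
          · exact Or.inl h
        · rcases ih with h | ⟨h, -⟩ | ⟨h, -⟩
          · exact Or.inr (Or.inr ⟨h, Relation.ReflTransGen.refl⟩)
          · exact Or.inl h
          · exact Or.inr (Or.inr ⟨h, Relation.ReflTransGen.refl⟩)
      · have hbc := G.reach_of_mem hf hfe
        rcases ih with h | ⟨h, h'⟩ | ⟨h, h'⟩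
        · exact Or.inl (h.trans hbc)
        · exact Or.inr (Or.inl ⟨h, h'.trans hbc⟩)
        · exact Or.inr (Or.inr ⟨h, h'.trans hbc⟩)
  · have hs : Δ ⊆ insert e Δ := Finset.subset_insert e Δ
    have hE := G.reach_of_mem (Finset.mem_insert_self e Δ) huv
    rintro (h | ⟨h, h'⟩ | ⟨h, h'⟩)
    · exact Reach.mono G hs h
    · exact ((Reach.mono G hs h).trans hE).trans (Reach.mono G hs h')
    · exact ((Reach.mono G hs h).trans (Reach.symm G hE)).trans (Reach.mono G hs h')

theorem ncompSpanning_insert_of_reach [DecidableEq E] {Δ : Finset E} {e : E} {u v : V}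
    (huv : G.ends e = s(u, v)) (h : G.Reach Δ u v) :
    G.ncompSpanning (insert e Δ) = G.ncompSpanning Δ := by
  have : G.component (insert e Δ) = G.component Δ := by
    ext x y
    change G.Reach (insert e Δ) x y ↔ G.Reach Δ x y
    rw [G.reach_insert huv]
    constructor
    · rintro (h1 | ⟨h1, h2⟩ | ⟨h1, h2⟩)
      · exact h1
      · exact (h1.trans h).trans h2
      · exact (h1.trans (Reach.symm G h)).trans h2
    · exact Or.inl
  rw [ncompSpanning_eq, ncompSpanning_eq, this]

theorem ncompSpanning_insert_of_not_reach [Finite V] [DecidableEq E] {Δ : Finset E} {e : E}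
    {u v : V} (huv : G.ends e = s(u, v)) (h : ¬ G.Reach Δ u v) :
    G.ncompSpanning (insert e Δ) + 1 = G.ncompSpanning Δ := by
  have hu : ∀ x, G.Reach Δ x u → G.component (insert e Δ) x =
      G.component Δ u ∪ G.component Δ v := by
    intro x hx
    ext y
    change G.Reach (insert e Δ) x y ↔ G.Reach Δ u y ∨ G.Reach Δ v y
    rw [G.reach_insert huv]
    constructor
    · rintro (h1 | ⟨-, h2⟩ | ⟨-, h2⟩)
      · exact Or.inl ((Reach.symm G hx).trans h1)
      · exact Or.inr h2
      · exact Or.inl h2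
    · rintro (h1 | h1)
      · exact Or.inl (hx.trans h1)
      · exact Or.inr (Or.inl ⟨hx, h1⟩)
  have hv : ∀ x, G.Reach Δ x v → G.component (insert e Δ) x =
      G.component Δ u ∪ G.component Δ v := by
    intro x hx
    rw [← hu u Relation.ReflTransGen.refl, component_eq_iff, G.reach_insert huv]
    exact Or.inr (Or.inr ⟨hx, Relation.ReflTransGen.refl⟩)
  have hx : ∀ x, ¬ G.Reach Δ x u → ¬ G.Reach Δ x v →
      G.component (insert e Δ) x = G.component Δ x := by
    intro x h1 h2
    ext y
    change G.Reach (insert e Δ) x y ↔ G.Reach Δ x y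
    rw [G.reach_insert huv]
    tauto
  have key : Set.range (G.component (insert e Δ)) = insert (G.component Δ u ∪ G.component Δ v)
      (Set.range (G.component Δ) \ {G.component Δ u, G.component Δ v}) := by
    ext S
    simp only [Set.mem_range, Set.mem_insert_iff, Set.mem_sdiff, Set.mem_singleton_iff, not_or]
    constructor
    · rintro ⟨x, rfl⟩
      by_cases h1 : G.Reach Δ x u
      · exact Or.inl (hu x h1)
      by_cases h2 : G.Reach Δ x v
      · exact Or.inl (hv x h2)
      rw [hx x h1 h2, component_eq_iff, component_eq_iff]
      exact Or.inr ⟨⟨x, rfl⟩, h1, h2⟩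
    · rintro (rfl | ⟨⟨x, rfl⟩, h1, h2⟩)
      · exact ⟨u, hu u Relation.ReflTransGen.refl⟩
      · rw [component_eq_iff] at h1 h2
        exact ⟨x, hx x h1 h2⟩
  have hnot : G.component Δ u ∪ G.component Δ v ∉
      Set.range (G.component Δ) \ {G.component Δ u, G.component Δ v} := by
    rintro ⟨⟨x, hxe⟩, hne⟩
    have : u ∈ G.component Δ x := by
      rw [hxe]
      exact Or.inl Relation.ReflTransGen.refl
    exact hne (Or.inl (hxe ▸ G.component_eq_iff.2 this))
  have hsub : ({G.component Δ u, G.component Δ v} : Set (Set V)) ⊆ Set.range (G.component Δ) := by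
    rintro S (rfl | rfl)
    · exact ⟨u, rfl⟩
    · exact ⟨v, rfl⟩
  have hpair : ({G.component Δ u, G.component Δ v} : Set (Set V)).ncard = 2 :=
    Set.ncard_pair fun h' => h (G.component_eq_iff.1 h')
  have hadd := Set.ncard_sdiff_add_ncard_of_subset hsub (Set.toFinite _)
  rw [ncompSpanning_eq, ncompSpanning_eq, key, Set.ncard_insert_of_notMem hnot (Set.toFinite _)]
  omega

theorem separating_iff [Fintype V] [Fintype E] [DecidableEq E] {e : E} {u v : V}
    (huv : G.ends e = s(u, v)) :
    G.Separating e ↔ ¬ G.Reach (Finset.univ \ {e}) u v := by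
  have hins : insert e (Finset.univ \ {e}) = (Finset.univ : Finset E) := by
    ext f
    simp
  unfold Separating
  by_cases h : G.Reach (Finset.univ \ {e}) u v
  · have := G.ncompSpanning_insert_of_reach huv h
    rw [hins] at this
    simp [this, h]
  · have := G.ncompSpanning_insert_of_not_reach huv h
    rw [hins] at this
    simp only [h, not_false_eq_true, iff_true]
    omega

section Betti

variable [Fintype V] [DecidableEq V]

theorem reach_iff_eq_of_notMem_verts {Δ : Finset E} {v w : V} (hv : v ∉ G.verts Δ) :
    G.Reach Δ v w ↔ v = w := by
  constructor
  · intro h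
    rcases Relation.ReflTransGen.cases_head h with h | ⟨c, ⟨e, he, hec⟩, -⟩
    · exact h
    · exact absurd (Finset.mem_filter.2 ⟨Finset.mem_univ v, e, he, by simp [hec]⟩) hv
  · rintro rfl
    exact Relation.ReflTransGen.refl

theorem ncompSpanning_eq_ncomp_add (Δ : Finset E) :
    G.ncompSpanning Δ = G.ncomp Δ + (G.verts Δ)ᶜ.card := by
  have hsing : ∀ v ∉ G.verts Δ, G.component Δ v = {v} := by
    intro v hv
    ext w
    change G.Reach Δ v w ↔ w = v
    rw [G.reach_iff_eq_of_notMem_verts hv, eq_comm]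
  have hrange : Set.range (G.component Δ) =
      {S : Set V | ∃ v ∈ G.verts Δ, S = {w | G.Reach Δ v w}} ∪
        (fun v : V => ({v} : Set V)) '' ((G.verts Δ)ᶜ : Finset V) := by
    ext S
    constructor
    · rintro ⟨v, rfl⟩
      by_cases hv : v ∈ G.verts Δ
      · exact Or.inl ⟨v, hv, rfl⟩
      · exact Or.inr ⟨v, by simpa using hv, (hsing v hv).symm⟩
    · rintro (⟨v, -, rfl⟩ | ⟨v, hv, rfl⟩)
      · exact ⟨v, rfl⟩
      · exact ⟨v, hsing v (by simpa using hv)⟩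
  have hdisj : Disjoint {S : Set V | ∃ v ∈ G.verts Δ, S = {w | G.Reach Δ v w}}
      ((fun v : V => ({v} : Set V)) '' ((G.verts Δ)ᶜ : Finset V)) := by
    rw [Set.disjoint_left]
    rintro S ⟨v, hv, rfl⟩ ⟨x, hx, hxe⟩
    have hvx : v ∈ ({x} : Set V) := by
      have : v ∈ {w | G.Reach Δ v w} := Relation.ReflTransGen.refl
      rwa [← hxe] at this
    rw [Set.mem_singleton_iff] at hvx
    subst hvx
    simp at hx
    exact hx hv
  rw [ncompSpanning_eq, hrange, Set.ncard_union_eq hdisj (Set.toFinite _) (Set.toFinite _),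
    Set.ncard_image_of_injective _ Set.singleton_injective, Set.ncard_coe_finset]
  rfl

theorem b1_eq (Δ : Finset E) :
    G.b1 Δ = (Δ.card : ℤ) - Fintype.card V + G.ncompSpanning Δ := by
  have h1 := G.ncompSpanning_eq_ncomp_add Δ
  have h2 := Finset.card_add_card_compl (G.verts Δ)
  unfold b1
  omega

variable [DecidableEq E]

theorem b1_insert_of_reach {Δ : Finset E} {e : E} (he : e ∉ Δ) {u v : V}
    (huv : G.ends e = s(u, v)) (h : G.Reach Δ u v) : G.b1 (insert e Δ) = G.b1 Δ + 1 := by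
  rw [b1_eq, b1_eq, G.ncompSpanning_insert_of_reach huv h, Finset.card_insert_of_notMem he]
  push_cast
  ring

theorem b1_insert_of_not_reach {Δ : Finset E} {e : E} (he : e ∉ Δ) {u v : V}
    (huv : G.ends e = s(u, v)) (h : ¬ G.Reach Δ u v) : G.b1 (insert e Δ) = G.b1 Δ := by
  rw [b1_eq, b1_eq, ← G.ncompSpanning_insert_of_not_reach huv h, Finset.card_insert_of_notMem he]
  push_cast
  ring

theorem b1_le_b1_insert (Δ : Finset E) (e : E) : G.b1 Δ ≤ G.b1 (insert e Δ) := by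
  by_cases he : e ∈ Δ
  · rw [Finset.insert_eq_of_mem he]
  obtain ⟨⟨u, v⟩, huv⟩ := Quot.exists_rep (G.ends e)
  by_cases h : G.Reach Δ u v
  · rw [G.b1_insert_of_reach he huv.symm h]
    omega
  · rw [G.b1_insert_of_not_reach he huv.symm h]

theorem b1_mono {Δ Δ' : Finset E} (h : Δ ⊆ Δ') : G.b1 Δ ≤ G.b1 Δ' := by
  have key : ∀ s : Finset E, G.b1 Δ ≤ G.b1 (s ∪ Δ) := by
    intro s
    induction s using Finset.induction_on with
    | empty => simp
    | insert e s _ ih =>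
      rw [Finset.insert_union]
      exact ih.trans (G.b1_le_b1_insert _ e)
  simpa [Finset.union_eq_left.2 h] using key Δ'

theorem b1_union_of_separating [Fintype E] (Δ s : Finset E) (hs : ∀ e ∈ s, G.Separating e) :
    G.b1 (s ∪ Δ) = G.b1 Δ := by
  induction s using Finset.induction_on with
  | empty => simp
  | insert e s _ ih =>
    rw [Finset.insert_union]
    have ih := ih fun f hf => hs f (Finset.mem_insert_of_mem hf)
    by_cases he : e ∈ s ∪ Δ
    · rw [Finset.insert_eq_of_mem he, ih]
    obtain ⟨⟨u, v⟩, huv⟩ := Quot.exists_rep (G.ends e)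
    have hsep := (G.separating_iff huv.symm).1 (hs e (Finset.mem_insert_self e s))
    rw [G.b1_insert_of_not_reach he huv.symm, ih]
    intro hr
    refine hsep (Reach.mono G ?_ hr)
    intro f hf
    simp only [Finset.mem_sdiff, Finset.mem_univ, Finset.mem_singleton, true_and]
    rintro rfl
    exact he hf

end Betti

section Parity

variable [DecidableEq V]

theorem deg_eq_sum {Δ : Finset E} (a b : E → V) (hab : ∀ e, G.ends e = s(a e, b e)) (w : V) :
    G.deg Δ w = ∑ e ∈ Δ, ((if a e = w then 1 else 0) + (if b e = w then 1 else 0)) := by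
  refine Finset.sum_congr rfl fun e _ => ?_
  rw [hab]
  by_cases h1 : a e = w <;> by_cases h2 : b e = w <;>
    simp [Sym2.diag, h1, h2, Ne.symm, eq_comm]

variable [Fintype V] [DecidableEq E]

/-- An even subgraph has no bridge. -/
theorem IsCyclic.reach_sdiff {Δ : Finset E} (hΔ : G.IsCyclic Δ) {e : E} (he : e ∈ Δ) {u v : V}
    (huv : G.ends e = s(u, v)) : G.Reach (Δ \ {e}) u v := by
  classical
  by_contra hr
  have hrep : ∀ e, ∃ p : V × V, G.ends e = s(p.1, p.2) := fun e =>
    (Quot.exists_rep (G.ends e)).imp fun p hp => hp.symm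
  choose p hp using hrep
  set S : Finset V := Finset.univ.filter fun w => G.Reach (Δ \ {e}) u w with hS
  have hmem : ∀ w, w ∈ S ↔ G.Reach (Δ \ {e}) u w := by simp [hS]
  have heven : Even (∑ w ∈ S, G.deg Δ w) := Finset.even_sum _ fun w _ => hΔ w
  have hsum : ∑ w ∈ S, G.deg Δ w =
      ∑ f ∈ Δ, ((if (p f).1 ∈ S then 1 else 0) + (if (p f).2 ∈ S then 1 else 0)) := by
    simp_rw [G.deg_eq_sum (fun f => (p f).1) (fun f => (p f).2) hp]
    rw [Finset.sum_comm]
    refine Finset.sum_congr rfl fun f _ => ?_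
    rw [Finset.sum_add_distrib, Finset.sum_ite_eq, Finset.sum_ite_eq]
  have hrest : Even (∑ f ∈ Δ \ {e},
      ((if (p f).1 ∈ S then 1 else 0) + (if (p f).2 ∈ S then 1 else 0))) := by
    refine Finset.even_sum _ fun f hf => ?_
    have hE := G.reach_of_mem hf (hp f)
    have : (p f).1 ∈ S ↔ (p f).2 ∈ S := by
      rw [hmem, hmem]
      exact ⟨fun h => h.trans hE, fun h => h.trans (Reach.symm G hE)⟩
    simp only [this]
    exact ⟨_, rfl⟩
  have hedge : (if (p e).1 ∈ S then 1 else 0) + (if (p e).2 ∈ S then 1 else 0) = 1 := by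
    have hu : u ∈ S := (hmem u).2 Relation.ReflTransGen.refl
    have hv : v ∉ S := fun h => hr ((hmem v).1 h)
    have hpe := hp e
    rw [huv, Sym2.eq_iff] at hpe
    rcases hpe with ⟨h1, h2⟩ | ⟨h1, h2⟩
    · simp [← h1, ← h2, hu, hv]
    · simp [← h1, ← h2, hu, hv]
  rw [hsum, ← Finset.sum_sdiff (Finset.singleton_subset_iff.2 he), Finset.sum_singleton,
    hedge] at heven
  exact (Nat.not_even_iff_odd.2 hrest.add_one) heven

theorem IsCyclic.not_separating [Fintype E] {Δ : Finset E} (hΔ : G.IsCyclic Δ) {e : E}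
    (he : e ∈ Δ) : ¬ G.Separating e := by
  obtain ⟨⟨u, v⟩, huv⟩ := Quot.exists_rep (G.ends e)
  rw [G.separating_iff huv.symm, not_not]
  exact Reach.mono G (Finset.sdiff_subset_sdiff (Finset.subset_univ Δ) le_rfl)
    (IsCyclic.reach_sdiff G hΔ he huv.symm)

theorem separating_of_b1_eq [Fintype E] {Δ : Finset E} (h : G.b1 Δ = G.b1 Finset.univ) {e : E}
    (he : e ∉ Δ) : G.Separating e := by
  obtain ⟨⟨u, v⟩, huv⟩ := Quot.exists_rep (G.ends e)
  rw [G.separating_iff huv.symm]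
  intro hr
  have hins : insert e (Finset.univ \ {e}) = (Finset.univ : Finset E) := by
    ext f
    simp
  have h1 := G.b1_insert_of_reach (by simp) huv.symm hr
  rw [hins] at h1
  have h2 : G.b1 Δ ≤ G.b1 (Finset.univ \ {e}) := by
    refine G.b1_mono fun f hf => ?_
    simp only [Finset.mem_sdiff, Finset.mem_univ, Finset.mem_singleton, true_and]
    rintro rfl
    exact he hf
  omega

end Parity

theorem mem_nonSepEdges [Fintype V] [Fintype E] [DecidableEq E] {e : E} :
    e ∈ G.nonSepEdges ↔ ¬ G.Separating e := by
  simp [nonSepEdges]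

end Multigraph

/-- `b₁(Γ) ∈ B_Γ` iff the set of non-separating edges is a cyclic subgraph. -/
theorem b1_mem_B_iff_nonsep_cyclic {V E : Type} [Fintype V] [Fintype E]
    [DecidableEq V] [DecidableEq E] (G : Multigraph V E) :
    G.b1 Finset.univ ∈ G.B ↔ G.IsCyclic G.nonSepEdges := by
  constructor
  · rintro ⟨Δ, hΔ, hb⟩
    have : G.nonSepEdges = Δ := by
      ext e
      rw [G.mem_nonSepEdges]
      refine ⟨fun h => ?_, fun h => Multigraph.IsCyclic.not_separating G hΔ h⟩
      by_contra he
      exact h (G.separating_of_b1_eq hb he)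
    rwa [this]
  · intro h
    refine ⟨G.nonSepEdges, h, ?_⟩
    have := G.b1_union_of_separating G.nonSepEdges G.nonSepEdgesᶜ fun e he => by
      simpa [G.mem_nonSepEdges] using he
    rw [← this, Finset.union_comm, Finset.union_compl]
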